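/- Let D be a Γ-invariant linear operator on compactly supported sections of finite propagation speed. Then there is a constant c > 0 such that for every finite-index normal subgroup Γ' of Γ, the pushdown D_{Γ'} satisfies ‖D_{Γ'}f‖_∞ ≤ c·‖f‖_∞ for every Γ'-equivariant f : Y → V, where ‖f‖_∞ := sup_{y∈Y} ‖f(y)‖. -/

import Mathlib

open scoped BigOperators
open Filter

noncomputable section

variable {Y Γ V : Type*}

section Defs

variable [Group Γ] [MulAction Γ Y]
variable [NormedAddCommGroup V] [InnerProductSpace ℂ V]

/-- The action of `γ ∈ Γ` on compactly (= finitely) supported sections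
`φ : Y →₀ V`, given by `(γ · φ)(y) = ρ(γ) φ(γ⁻¹ • y)`. -/
def secAct (ρ : Γ →* (V ≃ₗᵢ[ℂ] V)) (γ : Γ) (φ : Y →₀ V) : Y →₀ V :=
  Finsupp.equivMapDomain (MulAction.toPerm γ) (φ.mapRange (ρ γ) ((ρ γ).map_zero))

/-- A linear operator on compactly supported sections is `Γ`-invariant if it
commutes with the action of `Γ`. -/
def IsEquivariantOp (ρ : Γ →* (V ≃ₗᵢ[ℂ] V)) (D : (Y →₀ V) →ₗ[ℂ] (Y →₀ V)) : Prop :=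
  ∀ (γ : Γ) (φ : Y →₀ V), D (secAct ρ γ φ) = secAct ρ γ (D φ)

/-- The kernel `⟨x|D|y⟩ ∈ End(V)` of an operator `D`, characterized by
`⟨x|D|y⟩ v = (D δ_{y,v})(x)`. -/
def kernelOf (D : (Y →₀ V) →ₗ[ℂ] (Y →₀ V)) (x y : Y) : V →ₗ[ℂ] V :=
  (Finsupp.lapply x) ∘ₗ D ∘ₗ (Finsupp.lsingle y)

/-- `D` has finite propagation speed `≤ R`:
`supp (Dφ) ⊆ U_R(supp φ) = {x | ∃ y ∈ supp φ, d(x,y) ≤ R}`. -/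
def HasPropSpeed [MetricSpace Y] (D : (Y →₀ V) →ₗ[ℂ] (Y →₀ V)) (R : ℝ) : Prop :=
  ∀ (φ : Y →₀ V) (x : Y), D φ x ≠ 0 → ∃ y ∈ φ.support, dist x y ≤ R

/-- A set of representatives of the orbits of a group `G` acting on `Y`:
it contains exactly one point of every orbit. -/
def IsRepSet (G : Type*) [Group G] [MulAction G Y] (S : Set Y) : Prop :=
  ∀ y : Y, ∃! s, s ∈ S ∧ s ∈ MulAction.orbit G y

/-- The space `W_{Γ'}` of `Γ'`-equivariant functions `f : Y → V`,
i.e. `f(γ • y) = ρ(γ) f(y)` for all `γ ∈ Γ'`. -/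
def equivSubmodule (ρ : Γ →* (V ≃ₗᵢ[ℂ] V)) (Γ' : Subgroup Γ) : Submodule ℂ (Y → V) where
  carrier := {f | ∀ (γ : Γ') (y : Y), f ((γ : Γ) • y) = ρ (γ : Γ) (f y)}
  add_mem' := by intro f g hf hg γ y; simp only [Pi.add_apply, hf γ y, hg γ y, map_add]
  zero_mem' := by intro γ y; simp
  smul_mem' := by intro c f hf γ y; simp only [Pi.smul_apply, hf γ y, map_smul]

/-- The summation map `S_{Γ'} φ (y) = Σ_{γ ∈ Γ'} ρ(γ)⁻¹ φ(γ • y)`. -/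
def smap (ρ : Γ →* (V ≃ₗᵢ[ℂ] V)) (Γ' : Subgroup Γ) (φ : Y →₀ V) : Y → V :=
  fun y => ∑ᶠ γ : Γ', ρ ((γ : Γ)⁻¹) (φ ((γ : Γ) • y))

/-- `DG` is the pushdown of `D` to `W_{Γ'}`, i.e. `DG ∘ S_{Γ'} = S_{Γ'} ∘ D`. -/
def IsPushdown (ρ : Γ →* (V ≃ₗᵢ[ℂ] V)) (Γ' : Subgroup Γ)
    (D : (Y →₀ V) →ₗ[ℂ] (Y →₀ V))
    (DG : equivSubmodule (Y := Y) ρ Γ' →ₗ[ℂ] equivSubmodule (Y := Y) ρ Γ') : Prop :=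
  ∀ (w : equivSubmodule (Y := Y) ρ Γ') (φ : Y →₀ V),
    (w : Y → V) = smap ρ Γ' φ → ((DG w : Y → V) = smap ρ Γ' (D φ))

/-- The kernel `⟨x|D|y⟩`, as a continuous linear map on `V`. -/
def kernelOfL [FiniteDimensional ℂ V] (D : (Y →₀ V) →ₗ[ℂ] (Y →₀ V)) (x y : Y) : V →L[ℂ] V :=
  LinearMap.toContinuousLinearMap (kernelOf D x y)

/-- The heat kernel `⟨x|e^{zD}|y⟩ = Σ_{n ≥ 0} (zⁿ/n!) ⟨x|Dⁿ|y⟩`. -/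
def heatKer [FiniteDimensional ℂ V] (D : (Y →₀ V) →ₗ[ℂ] (Y →₀ V)) (z : ℂ) (x y : Y) :
    V →L[ℂ] V :=
  ∑' n : ℕ, (z ^ n / (n.factorial : ℂ)) • kernelOfL (D ^ n) x y

/-- The `Γ`-trace `tr_Γ e^{zD} = Σ_{s ∈ S} tr ⟨s|e^{zD}|s⟩`,
for a set `S` of representatives of the `Γ`-orbits. -/
def trGammaHeat [FiniteDimensional ℂ V] (D : (Y →₀ V) →ₗ[ℂ] (Y →₀ V)) (z : ℂ)
    (S : Set Y) : ℂ :=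
  ∑ᶠ s ∈ S, LinearMap.trace ℂ V ((heatKer D z s s : V →L[ℂ] V) : V →ₗ[ℂ] V)

/-- `tr e^{zT}` for an endomorphism `T` of a finite dimensional space,
via the exponential series `Σ_{n ≥ 0} (zⁿ/n!) tr(Tⁿ)`. -/
def trExp {W : Type*} [AddCommGroup W] [Module ℂ W] (T : W →ₗ[ℂ] W) (z : ℂ) : ℂ :=
  ∑' n : ℕ, z ^ n / (n.factorial : ℂ) * LinearMap.trace ℂ W (T ^ n)

end Defs

section Helpers

variable [Group Γ] [MulAction Γ Y]
variable [NormedAddCommGroup V] [InnerProductSpace ℂ V]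

theorem secAct_apply (ρ : Γ →* (V ≃ₗᵢ[ℂ] V)) (γ : Γ) (φ : Y →₀ V) (y : Y) :
    secAct ρ γ φ y = ρ γ (φ (γ⁻¹ • y)) := rfl

theorem secAct_single (ρ : Γ →* (V ≃ₗᵢ[ℂ] V)) (γ : Γ) (z : Y) (v : V) :
    secAct ρ γ (Finsupp.single z v) = Finsupp.single (γ • z) (ρ γ v) := by
  simp [secAct]

theorem map_inv_apply_self (ρ : Γ →* (V ≃ₗᵢ[ℂ] V)) (γ : Γ) (v : V) :
    ρ γ⁻¹ (ρ γ v) = v := by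
  simp

theorem map_apply_inv_self (ρ : Γ →* (V ≃ₗᵢ[ℂ] V)) (γ : Γ) (v : V) :
    ρ γ (ρ γ⁻¹ v) = v := by
  simp

theorem apply_eq_sum_kernelOf (D : (Y →₀ V) →ₗ[ℂ] (Y →₀ V)) (φ : Y →₀ V) (y : Y) :
    D φ y = ∑ z ∈ φ.support, kernelOf D y z (φ z) := by
  conv_lhs => rw [← Finsupp.sum_single φ]
  simp [Finsupp.sum, kernelOf]

theorem apply_eq_sum_row (D : (Y →₀ V) →ₗ[ℂ] (Y →₀ V)) (y : Y)
    (hrow : {z | kernelOf D y z ≠ 0}.Finite) (φ : Y →₀ V) :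
    D φ y = ∑ z ∈ hrow.toFinset, kernelOf D y z (φ z) := by
  classical
  rw [apply_eq_sum_kernelOf,
    Finset.sum_subset (Finset.subset_union_left (s₂ := hrow.toFinset)),
    ← Finset.sum_subset (Finset.subset_union_right (s₁ := φ.support))]
  · intro z _ hz
    have : kernelOf D y z = 0 := by simpa using hz
    simp [this]
  · intro z _ hz
    have : φ z = 0 := by simpa using hz
    simp [this]

theorem finite_row_of_hasPropSpeed [MetricSpace Y]
    (hball : ∀ (y : Y) (R : ℝ), (Metric.closedBall y R).Finite)
    (D : (Y →₀ V) →ₗ[ℂ] (Y →₀ V)) {R : ℝ} (hR : HasPropSpeed D R) (y : Y) :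
    {z | kernelOf D y z ≠ 0}.Finite := by
  refine (hball y R).subset fun z hz => ?_
  obtain ⟨v, hv⟩ : ∃ v, kernelOf D y z v ≠ 0 := by
    by_contra! h
    exact hz (LinearMap.ext h)
  obtain ⟨x, hx, hd⟩ := hR (Finsupp.single z v) y hv
  obtain rfl : x = z := by simpa using Finsupp.support_single_subset hx
  rwa [Metric.mem_closedBall, dist_comm]

theorem kernelOf_smul_smul {ρ : Γ →* (V ≃ₗᵢ[ℂ] V)} {D : (Y →₀ V) →ₗ[ℂ] (Y →₀ V)}
    (hinv : IsEquivariantOp ρ D) (γ : Γ) (x y : Y) (v : V) :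
    kernelOf D (γ • x) (γ • y) v = ρ γ (kernelOf D x y (ρ γ⁻¹ v)) := by
  have h := hinv γ (Finsupp.single y (ρ γ⁻¹ v))
  rw [secAct_single, map_apply_inv_self] at h
  change D (Finsupp.single (γ • y) v) (γ • x) = _
  rw [h, secAct_apply, inv_smul_smul]
  rfl

theorem norm_kernelOfL_smul_smul [FiniteDimensional ℂ V] {ρ : Γ →* (V ≃ₗᵢ[ℂ] V)}
    {D : (Y →₀ V) →ₗ[ℂ] (Y →₀ V)} (hinv : IsEquivariantOp ρ D) (γ : Γ) (x y : Y) :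
    ‖kernelOfL D (γ • x) (γ • y)‖ = ‖kernelOfL D x y‖ := by
  have key : ∀ (γ : Γ) (x y : Y), ‖kernelOfL D (γ • x) (γ • y)‖ ≤ ‖kernelOfL D x y‖ := by
    intro γ x y
    refine ContinuousLinearMap.opNorm_le_bound _ (norm_nonneg _) fun v => ?_
    change ‖kernelOf D (γ • x) (γ • y) v‖ ≤ _
    rw [kernelOf_smul_smul hinv, LinearIsometryEquiv.norm_map]
    exact (kernelOfL D x y).le_opNorm_of_le (LinearIsometryEquiv.norm_map _ v).le
  refine le_antisymm (key γ x y) ?_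
  simpa using key γ⁻¹ (γ • x) (γ • y)

/-- The `ℓ¹`-norm of the row `⟨y|D|·⟩` of the kernel of `D`. -/
def rowNorm [FiniteDimensional ℂ V] (D : (Y →₀ V) →ₗ[ℂ] (Y →₀ V)) (y : Y) : ℝ :=
  ∑ᶠ z, ‖kernelOfL D y z‖

theorem rowNorm_nonneg [FiniteDimensional ℂ V] (D : (Y →₀ V) →ₗ[ℂ] (Y →₀ V)) (y : Y) :
    0 ≤ rowNorm D y :=
  finsum_nonneg fun _ => norm_nonneg _

theorem rowNorm_smul [FiniteDimensional ℂ V] {ρ : Γ →* (V ≃ₗᵢ[ℂ] V)}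
    {D : (Y →₀ V) →ₗ[ℂ] (Y →₀ V)} (hinv : IsEquivariantOp ρ D) (γ : Γ) (y : Y) :
    rowNorm D (γ • y) = rowNorm D y := by
  rw [rowNorm, ← finsum_comp_equiv (MulAction.toPerm γ)]
  exact finsum_congr fun z => norm_kernelOfL_smul_smul hinv γ y z

theorem exists_rowNorm_le [FiniteDimensional ℂ V] {ρ : Γ →* (V ≃ₗᵢ[ℂ] V)}
    {D : (Y →₀ V) →ₗ[ℂ] (Y →₀ V)} (hinv : IsEquivariantOp ρ D)
    (horb : Finite (MulAction.orbitRel.Quotient Γ Y)) :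
    ∃ c : ℝ, 0 < c ∧ ∀ y : Y, rowNorm D y ≤ c := by
  obtain ⟨M, hM⟩ := (Set.finite_range
    fun q : MulAction.orbitRel.Quotient Γ Y => rowNorm D q.out).bddAbove
  refine ⟨max M 1, by positivity, fun y => le_max_of_le_left ?_⟩
  obtain ⟨γ, hγ⟩ := MulAction.orbitRel_apply.1 (Quotient.mk_out (s := MulAction.orbitRel Γ Y) y)
  have h := hM ⟨Quotient.mk (MulAction.orbitRel Γ Y) y, rfl⟩
  simp only at h hγ
  rwa [← hγ, rowNorm_smul hinv] at h

theorem norm_sum_kernelOf_le [FiniteDimensional ℂ V] (D : (Y →₀ V) →ₗ[ℂ] (Y →₀ V)) (y : Y)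
    (hrow : {z | kernelOf D y z ≠ 0}.Finite) (f : Y → V) {M : ℝ} (hM : ∀ z, ‖f z‖ ≤ M) :
    ‖∑ z ∈ hrow.toFinset, kernelOf D y z (f z)‖ ≤ rowNorm D y * M := by
  have hsupp : Function.support (fun z => ‖kernelOfL D y z‖) ⊆ (hrow.toFinset : Set Y) := by
    intro z hz
    rw [Set.Finite.coe_toFinset]
    intro h0
    apply hz
    simp [kernelOfL, h0]
  rw [rowNorm, finsum_eq_sum_of_support_subset _ hsupp, Finset.sum_mul]
  refine norm_sum_le_of_le _ fun z _ => ?_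
  exact (kernelOfL D y z).le_opNorm_of_le (hM z)

theorem finite_setOf_smul_mem (hfree : ∀ (γ : Γ) (y : Y), γ • y = y → γ = 1)
    (Γ' : Subgroup Γ) {A B : Set Y} (hA : A.Finite) (hB : B.Finite) :
    {γ : Γ' | ∃ z ∈ A, (γ : Γ) • z ∈ B}.Finite := by
  have : {γ : Γ' | ∃ z ∈ A, (γ : Γ) • z ∈ B} ⊆
      ⋃ z ∈ A, (fun γ : Γ' => (γ : Γ) • z) ⁻¹' B := by
    intro γ hγ
    simpa using hγ
  refine (hA.biUnion fun z _ => hB.preimage ?_).subset this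
  intro γ _ γ' _ h
  have h1 : ((γ' : Γ)⁻¹ * γ) • z = z := by
    rw [mul_smul, inv_smul_eq_iff]
    exact h
  exact Subtype.ext (inv_mul_eq_one.1 (hfree _ _ h1)).symm

theorem smap_apply_eq_sum_kernelOf (hfree : ∀ (γ : Γ) (y : Y), γ • y = y → γ = 1)
    {ρ : Γ →* (V ≃ₗᵢ[ℂ] V)} {D : (Y →₀ V) →ₗ[ℂ] (Y →₀ V)} (hinv : IsEquivariantOp ρ D)
    (Γ' : Subgroup Γ) (φ : Y →₀ V) (y : Y) (hrow : {z | kernelOf D y z ≠ 0}.Finite) :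
    smap ρ Γ' (D φ) y = ∑ z ∈ hrow.toFinset, kernelOf D y z (smap ρ Γ' φ z) := by
  have hF := finite_setOf_smul_mem hfree Γ' hrow φ.hasFiniteSupport
  have hD : ∀ γ : Γ', ρ (γ : Γ)⁻¹ (D φ ((γ : Γ) • y)) =
      ∑ z ∈ hrow.toFinset, kernelOf D y z (ρ (γ : Γ)⁻¹ (φ ((γ : Γ) • z))) := by
    intro γ
    have h := DFunLike.congr_fun (hinv (γ : Γ)⁻¹ φ) y
    rw [secAct_apply, inv_inv, apply_eq_sum_row D y hrow] at h
    rw [← h]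
    simp [secAct_apply]
  have hz : ∀ z ∈ hrow.toFinset, smap ρ Γ' φ z =
      ∑ γ ∈ hF.toFinset, ρ (γ : Γ)⁻¹ (φ ((γ : Γ) • z)) := by
    intro z hz
    refine finsum_eq_sum_of_support_subset _ fun γ hγ => ?_
    rw [Set.Finite.coe_toFinset]
    refine ⟨z, by simpa using hz, fun h0 => hγ ?_⟩
    simp [h0]
  have hy : smap ρ Γ' (D φ) y = ∑ γ ∈ hF.toFinset, ρ (γ : Γ)⁻¹ (D φ ((γ : Γ) • y)) := by
    refine finsum_eq_sum_of_support_subset _ fun γ hγ => ?_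
    rw [Set.Finite.coe_toFinset]
    by_contra hn
    refine hγ ?_
    simp only [hD]
    refine Finset.sum_eq_zero fun z hz => ?_
    have h0 : φ ((γ : Γ) • z) = 0 := by
      by_contra h0
      exact hn ⟨z, by simpa using hz, h0⟩
    simp [h0]
  rw [hy, Finset.sum_congr rfl fun γ _ => hD γ, Finset.sum_comm]
  exact Finset.sum_congr rfl fun z h => by rw [hz z h, map_sum]

theorem finite_orbitRel_quotient_subgroup (horb : Finite (MulAction.orbitRel.Quotient Γ Y))
    (Γ' : Subgroup Γ) [Γ'.FiniteIndex] : Finite (MulAction.orbitRel.Quotient Γ' Y) := by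
  refine Finite.of_surjective
    (fun p : (Γ ⧸ Γ') × MulAction.orbitRel.Quotient Γ Y =>
      Quotient.mk (MulAction.orbitRel Γ' Y) (p.1.out⁻¹ • p.2.out)) fun q => ?_
  obtain ⟨y, rfl⟩ := Quotient.exists_rep q
  obtain ⟨γ, hγ⟩ := MulAction.orbitRel_apply.1
    ((MulAction.orbitRel Γ Y).symm (Quotient.mk_out (s := MulAction.orbitRel Γ Y) y))
  obtain ⟨h, hh⟩ := QuotientGroup.mk_out_eq_mul Γ' γ⁻¹
  refine ⟨(QuotientGroup.mk γ⁻¹, Quotient.mk (MulAction.orbitRel Γ Y) y), Quotient.sound ?_⟩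
  refine MulAction.orbitRel_apply.2 ⟨h⁻¹, ?_⟩
  simp only at hγ ⊢
  rw [hh, mul_inv_rev, inv_inv, mul_smul, hγ]
  rfl

theorem bddAbove_norm_of_mem_equivSubmodule
    (ρ : Γ →* (V ≃ₗᵢ[ℂ] V)) (Γ' : Subgroup Γ) (hq : Finite (MulAction.orbitRel.Quotient Γ' Y))
    (f : equivSubmodule (Y := Y) ρ Γ') : BddAbove (Set.range fun y => ‖(f : Y → V) y‖) := by
  refine ((Set.finite_range fun q : MulAction.orbitRel.Quotient Γ' Y =>
    ‖(f : Y → V) q.out‖).subset ?_).bddAbove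
  rintro _ ⟨y, rfl⟩
  obtain ⟨γ, hγ⟩ := MulAction.orbitRel_apply.1 (Quotient.mk_out (s := MulAction.orbitRel Γ' Y) y)
  refine ⟨Quotient.mk _ y, ?_⟩
  simp only at hγ ⊢
  rw [← hγ, Subgroup.smul_def, f.2 γ y, LinearIsometryEquiv.norm_map]

theorem exists_smap_eq (hfree : ∀ (γ : Γ) (y : Y), γ • y = y → γ = 1)
    (ρ : Γ →* (V ≃ₗᵢ[ℂ] V)) (Γ' : Subgroup Γ) (hq : Finite (MulAction.orbitRel.Quotient Γ' Y))
    (f : equivSubmodule (Y := Y) ρ Γ') : ∃ φ : Y →₀ V, (f : Y → V) = smap ρ Γ' φ := by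
  classical
  let r : Y → Y := fun y => (Quotient.mk (MulAction.orbitRel Γ' Y) y).out
  have hr : ∀ (γ : Γ') (y : Y), r ((γ : Γ) • y) = r y := fun γ y =>
    congrArg Quotient.out (Quotient.sound (s := MulAction.orbitRel Γ' Y) ⟨γ, rfl⟩)
  have hfin : {y | r y = y}.Finite :=
    (Set.finite_range fun q : MulAction.orbitRel.Quotient Γ' Y => q.out).subset
      fun y hy => ⟨Quotient.mk _ y, hy⟩
  let φ : Y →₀ V := Finsupp.onFinset hfin.toFinset
    (fun y => if r y = y then (f : Y → V) y else 0) (by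
      intro y hy
      rw [Set.Finite.mem_toFinset]
      by_contra h
      exact hy (if_neg h))
  refine ⟨φ, funext fun y => ?_⟩
  obtain ⟨γ, hγ⟩ := MulAction.orbitRel_apply.1 (Quotient.mk_out (s := MulAction.orbitRel Γ' Y) y)
  have hγ' : (γ : Γ) • y = r y := hγ
  rw [smap, finsum_eq_single _ γ]
  · have : φ ((γ : Γ) • y) = (f : Y → V) ((γ : Γ) • y) := if_pos (by rw [hr, hγ'])
    rw [this, f.2 γ y, map_inv_apply_self]
  · intro γ' hne
    have : φ ((γ' : Γ) • y) = 0 := by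
      refine if_neg fun h => hne ?_
      rw [hr, ← hγ'] at h
      have h1 : ((γ' : Γ)⁻¹ * γ) • y = y := by
        rw [mul_smul, inv_smul_eq_iff]
        exact h
      exact Subtype.ext (inv_mul_eq_one.1 (hfree _ _ h1))
    rw [this, map_zero]

end Helpers

/-- Let `D` be `Γ`-invariant of finite propagation speed.  Then there is `c > 0`
such that for every finite-index normal subgroup `Γ'` of `Γ`, the pushdown
`D_{Γ'}` satisfies `‖D_{Γ'} f‖_∞ ≤ c ‖f‖_∞` for every `Γ'`-equivariant `f`,
where `‖f‖_∞ = sup_{y∈Y} ‖f y‖`. -/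
theorem pushdown_sup_norm_bound
    [MetricSpace Y] [Group Γ] [MulAction Γ Y]
    [NormedAddCommGroup V] [InnerProductSpace ℂ V] [FiniteDimensional ℂ V]
    (hball : ∀ (y : Y) (R : ℝ), (Metric.closedBall y R).Finite)
    (hiso : ∀ γ : Γ, Isometry (fun y : Y => γ • y))
    (hfree : ∀ (γ : Γ) (y : Y), γ • y = y → γ = 1)
    (horb : Finite (MulAction.orbitRel.Quotient Γ Y))
    (ρ : Γ →* (V ≃ₗᵢ[ℂ] V))
    (D : (Y →₀ V) →ₗ[ℂ] (Y →₀ V))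
    (hinv : IsEquivariantOp ρ D)
    (hprop : ∃ R : ℝ, HasPropSpeed D R) :
    ∃ c : ℝ, 0 < c ∧
      ∀ (Γ' : Subgroup Γ), Γ'.Normal → Γ'.FiniteIndex →
        ∀ (DG : equivSubmodule (Y := Y) ρ Γ' →ₗ[ℂ] equivSubmodule (Y := Y) ρ Γ'),
          IsPushdown ρ Γ' D DG →
          ∀ f : equivSubmodule (Y := Y) ρ Γ',
            (⨆ y : Y, ‖(DG f : Y → V) y‖) ≤ c * ⨆ y : Y, ‖(f : Y → V) y‖ := by
  obtain ⟨R, hR⟩ := hprop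
  have hrow := finite_row_of_hasPropSpeed hball D hR
  obtain ⟨c, hc, hle⟩ := exists_rowNorm_le hinv horb
  refine ⟨c, hc, fun Γ' _ _ DG hDG f => ?_⟩
  have hq := finite_orbitRel_quotient_subgroup horb Γ'
  obtain ⟨φ, hφ⟩ := exists_smap_eq hfree ρ Γ' hq f
  have hbdd := bddAbove_norm_of_mem_equivSubmodule ρ Γ' hq f
  have hnonneg : 0 ≤ ⨆ y : Y, ‖(f : Y → V) y‖ := Real.iSup_nonneg fun _ => norm_nonneg _
  refine Real.iSup_le (fun y => ?_) (by positivity)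
  rw [hDG f φ hφ, smap_apply_eq_sum_kernelOf hfree hinv Γ' φ y (hrow y), ← hφ]
  refine (norm_sum_kernelOf_le D y (hrow y) f fun z => le_ciSup hbdd z).trans ?_
  exact mul_le_mul_of_nonneg_right (hle y) hnonneg
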